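/- Let α, β, γ > 0 be real and t ∈ (0,1). Writing F(t) = E_{α,β}^γ(t) and defining the Laguerreian difference Δ_L(t) = (F'(t))² − F(t) F''(t), one has Δ_L(t) ≤ γ / ( Γ₀ Γ₁ t (1 − t)^{2γ+1} ), where Γ_p = inf_{n ∈ ℕ, n ≥ p} Γ(αn + β) for p = 0, 1. -/

import Mathlib

open scoped BigOperators

/-- Pochhammer symbol `(γ)_k = Γ(γ+k)/Γ(γ)`. -/
noncomputable def poch (γ : ℝ) (k : ℕ) : ℝ := Real.Gamma (γ + k) / Real.Gamma γ

/-- The Prabhakar (three-parameter Mittag-Leffler) function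
`E_{α,β}^γ(x) = ∑_{k≥0} (γ)_k x^k / (k! Γ(αk+β))`. -/
noncomputable def prabhakar (α β γ x : ℝ) : ℝ :=
  ∑' k : ℕ, poch γ k * x ^ k / (k.factorial * Real.Gamma (α * k + β))

/-- `Γ_p = inf_{n ∈ ℕ, n ≥ p} Γ(αn + β)`. -/
noncomputable def gammaInf (α β : ℝ) (p : ℕ) : ℝ :=
  ⨅ n : {m : ℕ // p ≤ m}, Real.Gamma (α * (n : ℕ) + β)

open Filter Topology

lemma poch_zero {g : ℝ} (hg : 0 < g) : poch g 0 = 1 := by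
  simp [poch, (Real.Gamma_pos_of_pos hg).ne']

lemma poch_pos {g : ℝ} (hg : 0 < g) (k : ℕ) : 0 < poch g k :=
  div_pos (Real.Gamma_pos_of_pos (by positivity)) (Real.Gamma_pos_of_pos hg)

lemma poch_succ_right {g : ℝ} (hg : 0 < g) (k : ℕ) : poch g (k + 1) = poch g k * (g + k) := by
  have h : Real.Gamma (g + (k + 1 : ℕ)) = (g + k) * Real.Gamma (g + k) := by
    rw [← Real.Gamma_add_one (by positivity)]
    push_cast
    ring_nf
  rw [poch, poch, h]
  ring

lemma poch_succ_left {g : ℝ} (hg : 0 < g) (k : ℕ) : poch g (k + 1) = g * poch (g + 1) k := by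
  have h : g + (k + 1 : ℕ) = g + 1 + k := by push_cast; ring
  have h0 := (Real.Gamma_pos_of_pos hg).ne'
  rw [poch, poch, h, Real.Gamma_add_one hg.ne']
  field_simp

lemma poch_eq_eval_ascPochhammer {g : ℝ} (hg : 0 < g) (k : ℕ) :
    poch g k = (ascPochhammer ℝ k).eval g := by
  induction k with
  | zero => simp [poch_zero hg]
  | succ k ih => rw [poch_succ_right hg, ascPochhammer_succ_eval, ih]

lemma choose_eq_poch_div_factorial {g : ℝ} (hg : 0 < g) (k : ℕ) :
    Ring.choose (g + k - 1) k = poch g k / k.factorial := by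
  have h := Ring.factorial_nsmul_multichoose_eq_ascPochhammer g k
  rw [Polynomial.ascPochhammer_smeval_eq_eval, ← poch_eq_eval_ascPochhammer hg, nsmul_eq_mul] at h
  rw [Ring.choose, eq_div_iff (by positivity), ← h, mul_comm]
  congr 2
  ring

/-- The binomial series `∑ (g)_k x^k / k! = (1 - x)^(-g)`. -/
lemma hasSum_poch {g x : ℝ} (hg : 0 < g) (hx : |x| < 1) :
    HasSum (fun k : ℕ => poch g k / k.factorial * x ^ k) (1 / (1 - x) ^ g) := by
  have h := (Real.one_div_one_sub_rpow_hasFPowerSeriesOnBall_zero g).hasSum (y := x) (by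
    simpa [Metric.mem_eball, edist_zero_right, ← ofReal_norm] using hx)
  simpa [FormalMultilinearSeries.ofScalars_apply_eq, choose_eq_poch_div_factorial hg, mul_comm] using h

lemma succ_mul_poch_div_factorial {g : ℝ} (hg : 0 < g) (k : ℕ) :
    ((k + 1 : ℕ) : ℝ) * (poch g (k + 1) / (k + 1).factorial) =
      g * (poch (g + 1) k / k.factorial) := by
  rw [poch_succ_left hg, Nat.factorial_succ]
  push_cast
  field_simp

/-- The binomial series with weights `w`. -/
noncomputable def weightedBinomial (g : ℝ) (w : ℕ → ℝ) (x : ℝ) : ℝ :=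
  ∑' k : ℕ, poch g k / k.factorial * w k * x ^ k

lemma norm_weighted_le {g M : ℝ} (hg : 0 < g) {w : ℕ → ℝ} (hw : ∀ k, |w k| ≤ M) {x r : ℝ}
    (hx : |x| ≤ r) (k : ℕ) :
    ‖poch g k / k.factorial * w k * x ^ k‖ ≤ M * (poch g k / k.factorial * r ^ k) := by
  have hc : 0 ≤ poch g k / k.factorial := div_nonneg (poch_pos hg k).le (by positivity)
  rw [norm_mul, norm_mul, norm_pow, Real.norm_eq_abs, Real.norm_eq_abs, Real.norm_eq_abs,
    abs_of_nonneg hc]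
  calc _ ≤ poch g k / k.factorial * M * r ^ k := by
        have := (abs_nonneg _).trans (hw k)
        gcongr
        exact hw k
    _ = _ := by ring

lemma hasSum_weightedBinomial {g M : ℝ} (hg : 0 < g) {w : ℕ → ℝ} (hw : ∀ k, |w k| ≤ M) {x : ℝ}
    (hx : |x| < 1) :
    HasSum (fun k : ℕ => poch g k / k.factorial * w k * x ^ k) (weightedBinomial g w x) :=
  (Summable.of_norm_bounded ((hasSum_poch hg (by rwa [abs_abs])).summable.mul_left M)
    (norm_weighted_le hg hw le_rfl)).hasSum

lemma hasDerivAt_weightedBinomial {g M : ℝ} (hg : 0 < g) {w : ℕ → ℝ} (hw : ∀ k, |w k| ≤ M)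
    {x : ℝ} (hx : |x| < 1) :
    HasDerivAt (weightedBinomial g w) (g * weightedBinomial (g + 1) (fun k => w (k + 1)) x) x := by
  obtain ⟨r, hxr, hr1⟩ := exists_between hx
  have hr : 0 < r := (abs_nonneg x).trans_lt hxr
  have hg1 : 0 < g + 1 := by linarith
  set d : ℕ → ℝ → ℝ := fun k y => poch g k / k.factorial * w k * (k * y ^ (k - 1)) with hd
  have hds : ∀ k y, d (k + 1) y =
      g * (poch (g + 1) k / k.factorial * w (k + 1) * y ^ k) := fun k y => by
    simp only [hd, Nat.add_sub_cancel]
    linear_combination w (k + 1) * y ^ k * succ_mul_poch_div_factorial hg k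
  have hd0 : ∀ y, d 0 y = 0 := fun y => by simp [hd]
  have hsum : HasSum (fun k => d k x) (g * weightedBinomial (g + 1) (fun k => w (k + 1)) x) := by
    rw [← hasSum_nat_add_iff' 1]
    simpa [hds, hd0] using
      (hasSum_weightedBinomial hg1 (w := fun k => w (k + 1)) (fun k => hw _) hx).mul_left g
  set u : ℕ → ℝ := fun k =>
    Nat.casesOn k 0 fun k => g * (M * (poch (g + 1) k / k.factorial * r ^ k)) with hu
  have hu_sum : Summable u := by
    rw [← summable_nat_add_iff 1]
    exact ((hasSum_poch hg1 (by rwa [abs_of_pos hr])).summable.mul_left M).mul_left g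
  rw [← hsum.tsum_eq]
  refine hasDerivAt_tsum_of_isPreconnected (t := Set.Ioo (-r) r) hu_sum isOpen_Ioo
    isPreconnected_Ioo (fun k y _ => (hasDerivAt_pow k y).const_mul _) (fun k y hy => ?_)
    (abs_lt.1 hxr) (hasSum_weightedBinomial hg hw hx).summable (abs_lt.1 hxr)
  cases k with
  | zero => exact (congrArg norm (hd0 y)).trans_le norm_zero.le
  | succ k =>
    have h := norm_weighted_le hg1 (w := fun k => w (k + 1)) (fun k => hw _) (abs_lt.2 hy).le k
    change ‖d (k + 1) y‖ ≤ g * _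
    rw [hds, norm_mul, Real.norm_of_nonneg hg.le]
    gcongr

lemma weightedBinomial_le {g M : ℝ} (hg : 0 < g) {w : ℕ → ℝ} (hw0 : ∀ k, 0 ≤ w k)
    (hw : ∀ k, w k ≤ M) {x : ℝ} (hx0 : 0 ≤ x) (hx : x < 1) :
    weightedBinomial g w x ≤ M * (1 / (1 - x) ^ g) := by
  have hx' : |x| < 1 := by rwa [abs_of_nonneg hx0]
  have hw' : ∀ k, |w k| ≤ M := fun k => by rw [abs_of_nonneg (hw0 k)]; exact hw k
  exact hasSum_le (fun k => (le_abs_self _).trans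
    (norm_weighted_le hg hw' (abs_of_nonneg hx0).le k))
    (hasSum_weightedBinomial hg hw' hx') ((hasSum_poch hg hx').mul_left M)

/-- Cauchy–Schwarz for the moments of a nonnegative sequence. -/
lemma sq_moment_one_le {p : ℕ → ℝ} (hp : ∀ k, 0 ≤ p k) {A B D : ℝ} (hA : HasSum p A)
    (hB : HasSum (fun k : ℕ => k * p k) B) (hD : HasSum (fun k : ℕ => (k : ℝ) ^ 2 * p k) D) :
    B ^ 2 ≤ A * D := by
  have h : ∀ x : ℝ, 0 ≤ A * (x * x) + -2 * B * x + D := fun x => by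
    have hs := ((hA.mul_left (x * x)).add (hB.mul_left (-2 * x))).add hD
    have := hs.nonneg fun k => by
      have : 0 ≤ ((k : ℝ) - x) ^ 2 * p k := mul_nonneg (sq_nonneg _) (hp k)
      linarith
    linarith
  have := discrim_le_zero h
  rw [discrim] at this
  linarith

lemma exists_pos_le_Gamma : ∃ c > 0, ∀ x > 0, c ≤ Real.Gamma x := by
  obtain ⟨x, hx, hmin⟩ := Real.exists_isMinOn_Gamma_Ioi
  exact ⟨_, Real.Gamma_pos_of_pos (by linarith [hx.1]), fun y hy => hmin hy⟩

lemma gammaInf_pos {α β : ℝ} (hα : 0 < α) (hβ : 0 < β) (p : ℕ) : 0 < gammaInf α β p := by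
  obtain ⟨c, hc, h⟩ := exists_pos_le_Gamma
  have : Nonempty {m : ℕ // p ≤ m} := ⟨⟨p, le_rfl⟩⟩
  exact hc.trans_le (le_ciInf fun n => h _ (by positivity))

lemma gammaInf_le {α β : ℝ} (hα : 0 < α) (hβ : 0 < β) {p k : ℕ} (hk : p ≤ k) :
    gammaInf α β p ≤ Real.Gamma (α * k + β) :=
  ciInf_le (f := fun n : {m : ℕ // p ≤ m} => Real.Gamma (α * (n : ℕ) + β))
    ⟨0, by rintro _ ⟨n, rfl⟩; exact (Real.Gamma_pos_of_pos (by positivity)).le⟩ ⟨k, hk⟩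

/-- For nonnegative weights, `F'(t)² - F(t) F''(t) ≤ F(t) F'(t) / t`, where `F`, `F'`, `F''` are
given by the weighted binomial series. -/
lemma weightedBinomial_laguerre_le {g M : ℝ} (hg : 0 < g) {w : ℕ → ℝ} (hw0 : ∀ k, 0 ≤ w k)
    (hw : ∀ k, w k ≤ M) {t : ℝ} (ht0 : 0 < t) (ht1 : t < 1) :
    (g * weightedBinomial (g + 1) (fun k => w (k + 1)) t) ^ 2 - weightedBinomial g w t *
        (g * ((g + 1) * weightedBinomial (g + 1 + 1) (fun k => w (k + 1 + 1)) t)) ≤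
      weightedBinomial g w t * (g * weightedBinomial (g + 1) (fun k => w (k + 1)) t) / t := by
  have hg1 : 0 < g + 1 := by linarith
  have hg2 : 0 < g + 1 + 1 := by linarith
  have ht : |t| < 1 := by rwa [abs_of_pos ht0]
  have hw' : ∀ k, |w k| ≤ M := fun k => by rw [abs_of_nonneg (hw0 k)]; exact hw k
  have hA := hasSum_weightedBinomial hg hw' ht
  have hS1 := hasSum_weightedBinomial hg1 (w := fun k => w (k + 1)) (fun k => hw' _) ht
  have hS2 := hasSum_weightedBinomial hg2 (w := fun k => w (k + 1 + 1)) (fun k => hw' _) ht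
  set A := weightedBinomial g w t
  set S1 := weightedBinomial (g + 1) (fun k => w (k + 1)) t
  set S2 := weightedBinomial (g + 1 + 1) (fun k => w (k + 1 + 1)) t
  set p : ℕ → ℝ := fun k => poch g k / k.factorial * w k * t ^ k with hp
  have hp0 : ∀ k, 0 ≤ p k := fun k => mul_nonneg
    (mul_nonneg (div_nonneg (poch_pos hg k).le (by positivity)) (hw0 k)) (by positivity)
  have hB : HasSum (fun k : ℕ => k * p k) (t * (g * S1)) := by
    rw [← hasSum_nat_add_iff' 1]
    convert! (hS1.mul_left g).mul_left t using 1
    · funext k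
      simp only [hp]
      linear_combination w (k + 1) * t ^ (k + 1) * succ_mul_poch_div_factorial hg k
    · simp
  have hC : HasSum (fun k : ℕ => (k : ℝ) * (k - 1) * p k) (t ^ 2 * (g * ((g + 1) * S2))) := by
    rw [← hasSum_nat_add_iff' 2]
    convert! ((hS2.mul_left (g + 1)).mul_left g).mul_left (t ^ 2) using 1
    · funext k
      have h1 := succ_mul_poch_div_factorial hg (k + 1)
      have h2 := succ_mul_poch_div_factorial hg1 k
      simp only [hp]
      push_cast at h1 h2 ⊢
      linear_combination w (k + 2) * t ^ (k + 2) * ((k + 1) * h1 + g * h2)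
    · simp [Finset.sum_range_succ]
  have hD : HasSum (fun k : ℕ => (k : ℝ) ^ 2 * p k)
      (t ^ 2 * (g * ((g + 1) * S2)) + t * (g * S1)) := by
    convert! hC.add hB using 2 with k
    ring
  have h := sq_moment_one_le hp0 hA hB hD
  rw [le_div_iff₀ ht0]
  refine le_of_mul_le_mul_left ?_ ht0
  linarith

/-- Functional upper bound for the Laguerreian difference on `(0,1)`:
`Δ_L(t) = (F'(t))² − F(t)F''(t) ≤ γ/(Γ₀ Γ₁ t (1-t)^{2γ+1})` for `F = E_{α,β}^γ`. -/
theorem laguerreian_difference_upper_bound (α β γ t : ℝ) (hα : 0 < α) (hβ : 0 < β)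
    (hγ : 0 < γ) (ht : t ∈ Set.Ioo (0 : ℝ) 1) :
    (deriv (fun x => prabhakar α β γ x) t) ^ 2
        - prabhakar α β γ t * deriv (deriv (fun x => prabhakar α β γ x)) t
      ≤ γ / (gammaInf α β 0 * gammaInf α β 1 * t * (1 - t) ^ (2 * γ + 1)) := by
  obtain ⟨ht0, ht1⟩ := ht
  have ht : |t| < 1 := by rwa [abs_of_pos ht0]
  have hγ1 : 0 < γ + 1 := by linarith
  set w : ℕ → ℝ := fun k => (Real.Gamma (α * k + β))⁻¹ with hw
  have hG0 := gammaInf_pos hα hβ 0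
  have hG1 := gammaInf_pos hα hβ 1
  have hw0 : ∀ k, 0 ≤ w k := fun k => inv_nonneg.2 (Real.Gamma_pos_of_pos (by positivity)).le
  have hwM : ∀ k, w k ≤ (gammaInf α β 0)⁻¹ := fun k =>
    inv_anti₀ hG0 (gammaInf_le hα hβ (Nat.zero_le k))
  have hwM1 : ∀ k, w (k + 1) ≤ (gammaInf α β 1)⁻¹ := fun k =>
    inv_anti₀ hG1 (gammaInf_le hα hβ (Nat.le_add_left 1 k))
  have hwabs : ∀ k, |w k| ≤ (gammaInf α β 0)⁻¹ := fun k => by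
    rw [abs_of_nonneg (hw0 k)]; exact hwM k
  have hF : (fun x => prabhakar α β γ x) = weightedBinomial γ w := by
    funext x
    refine tsum_congr fun k => ?_
    simp only [hw]
    ring
  have hF' : ∀ x, |x| < 1 → deriv (weightedBinomial γ w) x =
      γ * weightedBinomial (γ + 1) (fun k => w (k + 1)) x := fun x hx =>
    (hasDerivAt_weightedBinomial hγ hwabs hx).deriv
  have hF'' : deriv (deriv (weightedBinomial γ w)) t =
      γ * ((γ + 1) * weightedBinomial (γ + 1 + 1) (fun k => w (k + 1 + 1)) t) := by
    have hev : deriv (weightedBinomial γ w) =ᶠ[𝓝 t]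
        fun x => γ * weightedBinomial (γ + 1) (fun k => w (k + 1)) x := by
      filter_upwards [continuous_abs.continuousAt.eventually_lt continuousAt_const ht] with x hx
      exact hF' x hx
    rw [hev.deriv_eq]
    exact ((hasDerivAt_weightedBinomial hγ1 (w := fun k => w (k + 1)) (fun k => hwabs _)
      ht).const_mul γ).deriv
  rw [congrFun hF t, hF, hF' t ht, hF'']
  refine (weightedBinomial_laguerre_le hγ hw0 hwM ht0 ht1).trans ?_
  have h0 := weightedBinomial_le hγ hw0 hwM ht0.le ht1
  have h1 := weightedBinomial_le hγ1 (w := fun k => w (k + 1)) (fun k => hw0 _) hwM1 ht0.le ht1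
  have h1t : 0 < 1 - t := by linarith
  have hS1 : 0 ≤ weightedBinomial (γ + 1) (fun k => w (k + 1)) t :=
    tsum_nonneg fun k => mul_nonneg (mul_nonneg (div_nonneg (poch_pos hγ1 k).le (by positivity))
      (hw0 _)) (by positivity)
  calc _ ≤ (gammaInf α β 0)⁻¹ * (1 / (1 - t) ^ γ) *
        (γ * ((gammaInf α β 1)⁻¹ * (1 / (1 - t) ^ (γ + 1)))) / t := by gcongr
    _ = _ := by
      rw [show 2 * γ + 1 = γ + (γ + 1) by ring, Real.rpow_add h1t γ (γ + 1)]
      field_simp
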